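/- The series ∑_{n=0}^∞ ((1/2)_n (1/6)_n (5/6)_n)/((1)_n^3) · (4554n+279) · (-9/64000)^n equals 160√30/π. -/

import Mathlib

open Real

noncomputable def poch (a : ℝ) (n : ℕ) : ℝ := (ascPochhammer ℝ n).eval a

open Filter Topology

/-- value of a power series -/
noncomputable def psum (c : ℕ → ℝ) (x : ℝ) : ℝ := ∑' n, c n * x ^ n

/-- coefficients of the derivative -/
def Dc (c : ℕ → ℝ) (n : ℕ) : ℝ := ((n:ℝ) + 1) * c (n + 1)

/-- polynomially bounded coefficients -/
def PBd (c : ℕ → ℝ) : Prop := ∃ (K : ℝ) (k : ℕ), ∀ n : ℕ, |c n| ≤ K * ((n:ℝ) + 1) ^ k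

lemma summable_poly_geom (k : ℕ) {r : ℝ} (h0 : 0 ≤ r) (h1 : r < 1) :
    Summable (fun n : ℕ => ((n:ℝ) + 1) ^ k * r ^ n) := by
  rcases h0.eq_or_lt with h | h
  · subst h
    refine summable_of_ne_finset_zero (s := {0}) ?_
    intro n hn
    have : n ≠ 0 := by simpa using hn
    simp [this]
  · have h2 : Summable (fun n : ℕ => (n:ℝ) ^ k * r ^ n) :=
      summable_pow_mul_geometric_of_norm_lt_one k (by rwa [Real.norm_of_nonneg h0])
    have h3 := ((summable_nat_add_iff 1).2 h2).mul_right (1 / r)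
    refine h3.congr ?_
    intro n
    push_cast
    field_simp
    ring

lemma PBd.summable {c : ℕ → ℝ} (hc : PBd c) {x : ℝ} (hx : |x| < 1) :
    Summable (fun n => c n * x ^ n) := by
  obtain ⟨K, k, h⟩ := hc
  refine Summable.of_norm_bounded ((summable_poly_geom k (abs_nonneg x) hx).mul_left K) ?_
  intro n
  rw [Real.norm_eq_abs, abs_mul, abs_pow, ← mul_assoc]
  exact mul_le_mul_of_nonneg_right (h n) (by positivity)

lemma PBd.dc {c : ℕ → ℝ} (hc : PBd c) : PBd (Dc c) := by
  obtain ⟨K, k, h⟩ := hc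
  have hK : 0 ≤ K := by
    have := h 0
    simp at this
    exact (abs_nonneg _).trans this
  refine ⟨K * 2 ^ k, k + 1, fun n => ?_⟩
  have h1 := h (n + 1)
  rw [Dc, abs_mul, abs_of_nonneg (by positivity : (0:ℝ) ≤ (n:ℝ) + 1)]
  have h2 : (((n + 1 : ℕ) : ℝ) + 1) ^ k ≤ (2 * ((n:ℝ) + 1)) ^ k := by
    apply pow_le_pow_left₀ (by positivity)
    push_cast
    linarith [(Nat.cast_nonneg n : (0:ℝ) ≤ n)]
  calc ((n:ℝ) + 1) * |c (n + 1)| ≤ ((n:ℝ) + 1) * (K * (2 * ((n:ℝ) + 1)) ^ k) := by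
        apply mul_le_mul_of_nonneg_left _ (by positivity)
        exact h1.trans (mul_le_mul_of_nonneg_left h2 hK)
    _ = K * 2 ^ k * ((n:ℝ) + 1) ^ (k + 1) := by rw [mul_pow]; ring

lemma PBd.hasDerivAt {c : ℕ → ℝ} (hc : PBd c) {x : ℝ} (hx : |x| < 1) :
    HasDerivAt (psum c) (psum (Dc c) x) x := by
  obtain ⟨r, hr1, hr2⟩ := exists_between hx
  have hr0 : 0 ≤ r := (abs_nonneg x).trans hr1.le
  have hrr : |r| < 1 := by rwa [abs_of_nonneg hr0]
  have hd := hc.dc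
  obtain ⟨K, k, hK⟩ := hd
  -- bound sequence
  set u : ℕ → ℝ := fun n => |(n:ℝ) * c n * r ^ (n - 1)| with hu
  have hus : Summable u := by
    rw [← summable_nat_add_iff 1]
    have := (hc.dc.summable hrr).abs
    refine this.congr ?_
    intro n
    simp [hu, Dc]
    left; left; positivity
  have key := hasDerivAt_tsum_of_isPreconnected (u := u) (g := fun n y => c n * y ^ n)
    (g' := fun n y => c n * ((n:ℝ) * y ^ (n - 1))) (t := Metric.ball (0:ℝ) r) (y₀ := 0) (y := x)
    hus Metric.isOpen_ball (convex_ball (0:ℝ) r).isPreconnected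
    (fun n y _ => (hasDerivAt_pow n y).const_mul (c n)) ?_ ?_ ?_ ?_
  · have e : (∑' n, c n * ((n:ℝ) * x ^ (n - 1))) = psum (Dc c) x := by
      have hs : Summable (fun n : ℕ => c n * ((n:ℝ) * x ^ (n - 1))) := by
        rw [← summable_nat_add_iff 1]
        refine (hc.dc.summable hx).congr ?_
        intro n
        simp [Dc]; ring
      rw [hs.tsum_eq_zero_add, psum]
      simp only [Nat.cast_zero, zero_mul, mul_zero, zero_add]
      refine tsum_congr fun n => ?_
      simp [Dc]; ring
    rw [e] at key
    exact key
  · intro n y hy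
    have hy' : |y| ≤ r := by
      have := mem_ball_zero_iff.1 hy
      rw [Real.norm_eq_abs] at this
      exact this.le
    simp only [hu, Real.norm_eq_abs, abs_mul, abs_pow, abs_of_nonneg hr0]
    have : |y| ^ (n - 1) ≤ r ^ (n - 1) := pow_le_pow_left₀ (abs_nonneg y) hy' _
    calc |c n| * (|(n:ℝ)| * |y| ^ (n - 1)) = |(n:ℝ)| * |c n| * |y| ^ (n - 1) := by ring
      _ ≤ _ := mul_le_mul_of_nonneg_left this (by positivity)
  · exact Metric.mem_ball_self ((abs_nonneg x).trans_lt hr1)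
  · exact hc.summable (by simp)
  · rw [mem_ball_zero_iff, Real.norm_eq_abs]; exact hr1

/-- `(a)_n / n!` -/
noncomputable def rr (a : ℝ) (n : ℕ) : ℝ := ∏ i ∈ Finset.range n, (a + i) / (1 + i)

lemma rr_zero (a : ℝ) : rr a 0 = 1 := by simp [rr]

lemma rr_succ (a : ℝ) (n : ℕ) : rr a (n + 1) = rr a n * ((a + n) / (1 + n)) := by
  rw [rr, rr, Finset.prod_range_succ]

lemma rr_nonneg {a : ℝ} (h : 0 ≤ a) (n : ℕ) : 0 ≤ rr a n :=
  Finset.prod_nonneg fun i _ => by positivity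

lemma rr_le_one {a : ℝ} (h : 0 ≤ a) (h1 : a ≤ 1) (n : ℕ) : rr a n ≤ 1 :=
  Finset.prod_le_one (fun i _ => by positivity) fun i _ => by
    rw [div_le_one (by positivity)]; linarith

/-- coefficients of `₂F₁(a,b;1;x)` -/
noncomputable def hc (a b : ℝ) (n : ℕ) : ℝ := rr a n * rr b n

lemma hc_zero (a b : ℝ) : hc a b 0 = 1 := by simp [hc, rr_zero]

lemma hc_succ (a b : ℝ) (n : ℕ) :
    ((n:ℝ) + 1) ^ 2 * hc a b (n + 1) = (n + a) * (n + b) * hc a b n := by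
  simp only [hc, rr_succ]
  have : (1:ℝ) + n ≠ 0 := by positivity
  field_simp
  ring

lemma hc_nonneg {a b : ℝ} (ha : 0 ≤ a) (hb : 0 ≤ b) (n : ℕ) : 0 ≤ hc a b n :=
  mul_nonneg (rr_nonneg ha n) (rr_nonneg hb n)

lemma hc_bd {a b : ℝ} (ha : 0 ≤ a) (ha1 : a ≤ 1) (hb : 0 ≤ b) (hb1 : b ≤ 1) : PBd (hc a b) := by
  refine ⟨1, 0, fun n => ?_⟩
  rw [abs_of_nonneg (hc_nonneg ha hb n)]
  simp
  exact mul_le_one₀ (rr_le_one ha ha1 n) (rr_nonneg hb n) (rr_le_one hb hb1 n)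

lemma psum_split {c : ℕ → ℝ} (h : PBd c) {x : ℝ} (hx : |x| < 1) :
    psum c x = c 0 + x * psum (fun n => c (n + 1)) x := by
  rw [psum, (h.summable hx).tsum_eq_zero_add, psum, ← tsum_mul_left]
  simp only [pow_zero, mul_one]
  congr 1
  refine tsum_congr fun n => by ring

lemma hasSum_shift {f g : ℕ → ℝ} {S x : ℝ} (h : HasSum g S) (h0 : f 0 = 0)
    (h1 : ∀ n, f (n + 1) = x * g n) : HasSum f (x * S) := by
  rw [← hasSum_nat_add_iff' 1]
  simp only [Finset.range_one, Finset.sum_singleton, h0, sub_zero, h1]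
  exact h.mul_left x

/-- the hypergeometric differential equation -/
lemma hyp_ode {a b : ℝ} (ha : 0 ≤ a) (ha1 : a ≤ 1) (hb : 0 ≤ b) (hb1 : b ≤ 1) {x : ℝ}
    (hx : |x| < 1) :
    x * (1 - x) * psum (Dc (Dc (hc a b))) x + (1 - (a + b + 1) * x) * psum (Dc (hc a b)) x
      - a * b * psum (hc a b) x = 0 := by
  have h0 := hc_bd ha ha1 hb hb1
  have s0 := (h0.summable hx).hasSum
  have s1 := (h0.dc.summable hx).hasSum
  have s2 := (h0.dc.dc.summable hx).hasSum
  have e1 := hasSum_shift (f := fun n : ℕ => (n:ℝ) * hc a b n * x ^ n) (x := x) s1 (by simp)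
    (fun n => by simp only [Dc]; push_cast; ring)
  have e2 := hasSum_shift (f := fun n : ℕ => (n:ℝ) * Dc (hc a b) n * x ^ n) (x := x) s2 (by simp)
    (fun n => by simp only [Dc]; push_cast; ring)
  have e3 := hasSum_shift (f := fun n : ℕ => (n:ℝ) * ((n:ℝ) - 1) * hc a b n * x ^ n) (x := x) e2
    (by simp) (fun n => by simp only [Dc]; push_cast; ring)
  have tot := (((e2.sub e3).add s1).sub (e1.mul_left (a + b + 1))).sub (s0.mul_left (a * b))
  have z : HasSum (fun _ : ℕ => (0:ℝ)) 0 := hasSum_zero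
  have := tot.unique (z.congr_fun ?_)
  · simp only [psum]
    linear_combination this
  · intro n
    have := hc_succ a b n
    simp only [Dc]
    linear_combination x ^ n * this

lemma rr_tendsto {s : ℝ} (hs : 0 < s) :
    Tendsto (fun n : ℕ => rr s n * (n:ℝ) ^ (1 - s)) atTop (𝓝 (1 / Gamma s)) := by
  have hG : Gamma s ≠ 0 := (Gamma_pos_of_pos hs).ne'
  have h1 := (Real.GammaSeq_tendsto_Gamma s).inv₀ hG
  have h2 : Tendsto (fun n : ℕ => (n:ℝ) / (n + s)) atTop (𝓝 1) := tendsto_natCast_div_add_atTop s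
  have h3 := h1.mul h2
  rw [mul_one, ← one_div] at h3
  refine h3.congr' ?_
  filter_upwards [eventually_gt_atTop 0] with n hn
  have hn' : (0:ℝ) < n := by exact_mod_cast hn
  have e : rr s n = (∏ j ∈ Finset.range n, (s + j)) / (n.factorial : ℝ) := by
    rw [rr, Finset.prod_div_distrib]
    congr 1
    rw [← Finset.prod_range_add_one_eq_factorial]
    push_cast
    exact Finset.prod_congr rfl fun i _ => add_comm _ _
  rw [Real.GammaSeq, e, Finset.prod_range_succ, Real.rpow_sub hn', Real.rpow_one]
  have : (∏ j ∈ Finset.range n, (s + (j:ℝ))) ≠ 0 :=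
    Finset.prod_ne_zero_iff.2 fun i _ => by positivity
  have h4 : (n.factorial : ℝ) ≠ 0 := by positivity
  have h5 : (n:ℝ) ^ s ≠ 0 := by positivity
  have h6 : (n:ℝ) + s ≠ 0 := by positivity
  have h7 : s + (n:ℝ) ≠ 0 := by positivity
  field_simp
  ring

lemma hc_tendsto {a b : ℝ} (ha : 0 < a) (hb : 0 < b) :
    Tendsto (fun n : ℕ => hc a b n * (n:ℝ) ^ (2 - a - b)) atTop
      (𝓝 (1 / (Gamma a * Gamma b))) := by
  have := (rr_tendsto ha).mul (rr_tendsto hb)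
  rw [one_div_mul_one_div] at this
  refine this.congr' ?_
  filter_upwards [eventually_gt_atTop 0] with n hn
  have hn' : (0:ℝ) < n := by exact_mod_cast hn
  have : (n:ℝ) ^ (2 - a - b) = (n:ℝ) ^ (1 - a) * (n:ℝ) ^ (1 - b) := by
    rw [← Real.rpow_add hn']; congr 1; ring
  rw [hc, this]; ring

lemma hc_summable {a b : ℝ} (ha : 0 < a) (hb : 0 < b) (hab : a + b < 1) :
    Summable (hc a b) := by
  have h1 : Summable (fun n : ℕ => (n:ℝ) ^ (-(2 - a - b))) :=
    Real.summable_nat_rpow.2 (by linarith)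
  refine summable_of_isBigO_nat h1 ?_
  have h2 := (hc_tendsto ha hb).isBigO_one ℝ
  have h3 := h2.mul (Asymptotics.isBigO_refl (fun n : ℕ => (n:ℝ) ^ (-(2 - a - b))) atTop)
  refine (h3.congr' ?_ ?_)
  · filter_upwards [eventually_gt_atTop 0] with n hn
    have hn' : (0:ℝ) < n := by exact_mod_cast hn
    rw [Real.rpow_neg hn'.le]
    have : (n:ℝ) ^ (2 - a - b) ≠ 0 := by positivity
    field_simp
  · filter_upwards with n
    simp

lemma hc_mul_tendsto {a b : ℝ} (ha : 0 < a) (hb : 0 < b) (hab : a + b < 1) :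
    Tendsto (fun n : ℕ => (n:ℝ) * hc a b n) atTop (𝓝 0) := by
  have h1 : Tendsto (fun n : ℕ => (n:ℝ) ^ (-(1 - a - b))) atTop (𝓝 0) :=
    (tendsto_rpow_neg_atTop (by linarith)).comp tendsto_natCast_atTop_atTop
  have := (hc_tendsto ha hb).mul h1
  rw [mul_zero] at this
  refine this.congr' ?_
  filter_upwards [eventually_gt_atTop 0] with n hn
  have hn' : (0:ℝ) < n := by exact_mod_cast hn
  rw [mul_assoc, ← Real.rpow_add hn']
  have : 2 - a - b + -(1 - a - b) = 1 := by ring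
  rw [this, Real.rpow_one]; ring

/-- terms of `₂F₁(a,b;1+m;1)` -/
noncomputable def tt (a b : ℝ) (m n : ℕ) : ℝ :=
  ∏ i ∈ Finset.range n, ((a + i) * (b + i)) / ((1 + i) * (1 + m + i))

lemma tt_zero (a b : ℝ) (m : ℕ) : tt a b m 0 = 1 := by simp [tt]

lemma tt_succ (a b : ℝ) (m n : ℕ) :
    tt a b m (n + 1) = tt a b m n * (((a + n) * (b + n)) / ((1 + n) * (1 + m + n))) := by
  rw [tt, tt, Finset.prod_range_succ]

lemma tt_nonneg {a b : ℝ} (ha : 0 < a) (hb : 0 < b) (m n : ℕ) : 0 ≤ tt a b m n :=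
  Finset.prod_nonneg fun i _ => by positivity

lemma tt_base (a b : ℝ) (n : ℕ) : tt a b 0 n = hc a b n := by
  rw [tt, hc, rr, rr, ← Finset.prod_mul_distrib]
  refine Finset.prod_congr rfl fun i _ => ?_
  rw [div_mul_div_comm]; simp

lemma tt_le {a b : ℝ} (ha : 0 < a) (hb : 0 < b) (m n : ℕ) : tt a b m n ≤ hc a b n := by
  rw [← tt_base]
  refine Finset.prod_le_prod (fun i _ => by positivity) fun i _ => ?_
  apply div_le_div_of_nonneg_left (by positivity) (by positivity)
  apply mul_le_mul_of_nonneg_left _ (by positivity)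
  simp

lemma tt_le' {a b : ℝ} (ha : 0 < a) (hb : 0 < b) (m n : ℕ) :
    tt a b m (n + 1) ≤ (1 / (1 + m)) * hc a b (n + 1) := by
  rw [← tt_base, tt, tt, Finset.prod_range_succ', Finset.prod_range_succ' _ n]
  have h : (∏ k ∈ Finset.range n, ((a + ((k + 1 : ℕ) : ℝ)) * (b + ((k + 1 : ℕ) : ℝ))) /
      ((1 + ((k + 1 : ℕ) : ℝ)) * (1 + m + ((k + 1 : ℕ) : ℝ)))) ≤
      ∏ k ∈ Finset.range n, ((a + ((k + 1 : ℕ) : ℝ)) * (b + ((k + 1 : ℕ) : ℝ))) /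
      ((1 + ((k + 1 : ℕ) : ℝ)) * (1 + (0:ℕ) + ((k + 1 : ℕ) : ℝ))) := by
    refine Finset.prod_le_prod (fun i _ => by positivity) fun i _ => ?_
    apply div_le_div_of_nonneg_left (by positivity) (by positivity)
    apply mul_le_mul_of_nonneg_left _ (by positivity)
    simp
  have h2 : (0:ℝ) ≤ ((a + (0:ℕ)) * (b + (0:ℕ))) / ((1 + (0:ℕ)) * (1 + m + (0:ℕ))) := by
    positivity
  refine (mul_le_mul_of_nonneg_right h h2).trans_eq ?_
  simp
  ring

lemma tt_summable {a b : ℝ} (ha : 0 < a) (hb : 0 < b) (hab : a + b < 1) (m : ℕ) :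
    Summable (tt a b m) :=
  Summable.of_nonneg_of_le (tt_nonneg ha hb m) (tt_le ha hb m) (hc_summable ha hb hab)

lemma tt_contig {a b : ℝ} (ha : 0 < a) (hb : 0 < b) (hab : a + b < 1) (m : ℕ) :
    (1 + m) * (1 + m - a - b) * ∑' n, tt a b m n
      = (1 + m - a) * (1 + m - b) * ∑' n, tt a b (m + 1) n := by
  have hcN : (0:ℝ) < 1 + m := by positivity
  have rel : ∀ n, tt a b (m + 1) n * (1 + m + n) = tt a b m n * (1 + m) := by
    intro n
    induction n with
    | zero => simp [tt_zero]
    | succ k ih =>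
      rw [tt_succ, tt_succ]
      have h1 : (1:ℝ) + k ≠ 0 := by positivity
      have h2 : (1:ℝ) + m + k ≠ 0 := by positivity
      have h3 : (1:ℝ) + ((m + 1 : ℕ) : ℝ) + k ≠ 0 := by positivity
      have h4 : (1:ℝ) + m + ((k + 1 : ℕ) : ℝ) = 1 + ((m + 1 : ℕ) : ℝ) + k := by
        push_cast; ring
      rw [h4]
      have e : tt a b (m + 1) k = tt a b m k * (1 + m) / (1 + m + k) := by
        rw [eq_div_iff h2]; exact ih
      rw [e]
      field_simp
  have s1 := (tt_summable ha hb hab m).hasSum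
  have s2 := (tt_summable ha hb hab (m + 1)).hasSum
  have s3 := (s1.mul_left ((1 + m) * (1 + m - a - b))).sub
    (s2.mul_left ((1 + (m:ℝ) - a) * (1 + m - b)))
  have tel : ∀ N : ℕ, ∑ n ∈ Finset.range N, ((1 + (m:ℝ)) * (1 + m - a - b) * tt a b m n
      - (1 + (m:ℝ) - a) * (1 + m - b) * tt a b (m + 1) n) = -((1 + m) * (N * tt a b m N)) := by
    intro N
    induction N with
    | zero => simp
    | succ k ih =>
      rw [Finset.sum_range_succ, ih, tt_succ]
      have h1 : (1:ℝ) + k ≠ 0 := by positivity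
      have h2 : (1:ℝ) + m + k ≠ 0 := by positivity
      have e : tt a b (m + 1) k = tt a b m k * (1 + m) / (1 + m + k) := by
        rw [eq_div_iff h2]; exact rel k
      rw [e]
      push_cast
      field_simp
      ring
  have l1 := s3.tendsto_sum_nat
  have l2 : Tendsto (fun N : ℕ => -((1 + (m:ℝ)) * (N * tt a b m N))) atTop (𝓝 0) := by
    have : Tendsto (fun N : ℕ => (N:ℝ) * tt a b m N) atTop (𝓝 0) :=
      squeeze_zero (fun N => mul_nonneg (Nat.cast_nonneg N) (tt_nonneg ha hb m N))
        (fun N => mul_le_mul_of_nonneg_left (tt_le ha hb m N) (Nat.cast_nonneg N))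
        (hc_mul_tendsto ha hb hab)
    simpa using (this.const_mul (1 + (m:ℝ))).neg
  have := tendsto_nhds_unique (l1.congr tel) l2
  linarith

/-- Gauss' theorem with `c = 1`. -/
lemma gauss {a b : ℝ} (ha : 0 < a) (hb : 0 < b) (hab : a + b < 1) :
    ∑' n, hc a b n = Gamma (1 - a - b) / (Gamma (1 - a) * Gamma (1 - b)) := by
  set S : ℕ → ℝ := fun m => ∑' n, tt a b m n with hS
  have hS0 : S 0 = ∑' n, hc a b n := tsum_congr fun n => tt_base a b n
  have lim : Tendsto S atTop (𝓝 1) := by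
    have hsum := (summable_nat_add_iff 1).2 (hc_summable ha hb hab)
    have e : ∀ m, S m = 1 + ∑' n, tt a b m (n + 1) := by
      intro m
      rw [hS]
      simp only
      rw [(tt_summable ha hb hab m).tsum_eq_zero_add, tt_zero]
    have l1 : Tendsto (fun m : ℕ => ∑' n, tt a b m (n + 1)) atTop (𝓝 0) := by
      have l2 : Tendsto (fun m : ℕ => (1 / (1 + (m:ℝ))) * ∑' n, hc a b (n + 1)) atTop (𝓝 0) := by
        have := (tendsto_one_div_add_atTop_nhds_zero_nat (𝕜 := ℝ)).mul_const
          (∑' n, hc a b (n + 1))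
        rw [zero_mul] at this
        exact this.congr fun m => by rw [add_comm]
      refine squeeze_zero (fun m => tsum_nonneg fun n => tt_nonneg ha hb m _) (fun m => ?_) l2
      rw [← tsum_mul_left]
      exact Summable.tsum_le_tsum (fun n => tt_le' ha hb m n)
        ((summable_nat_add_iff 1).2 (tt_summable ha hb hab m)) (hsum.mul_left _)
    have := l1.const_add 1
    rw [add_zero] at this
    exact this.congr fun m => (e m).symm
  have prod : ∀ m, S 0 * rr (1 - a - b) m = rr (1 - a) m * rr (1 - b) m * S m := by
    intro m
    induction m with
    | zero => simp [rr_zero]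
    | succ k ih =>
      have h := tt_contig ha hb hab k
      have h1 : (1:ℝ) + k ≠ 0 := by positivity
      rw [rr_succ, rr_succ, rr_succ, ← mul_assoc, ih]
      change _ * (1 + (k:ℝ) - a - b) * S k = _ * S (k + 1) at h
      have e : ((1:ℝ) - a - b + k) / (1 + k) * S k
          = ((1 - a + k) / (1 + k)) * ((1 - b + k) / (1 + k)) * S (k + 1) := by
        field_simp
        linear_combination h
      linear_combination rr (1 - a) k * rr (1 - b) k * e
  have la := rr_tendsto (s := 1 - a) (by linarith)
  have lb := rr_tendsto (s := 1 - b) (by linarith)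
  have lc := rr_tendsto (s := 1 - a - b) (by linarith)
  have L1 := lc.const_mul (S 0)
  have L2 := (la.mul lb).mul lim
  have : Tendsto (fun n : ℕ => S 0 * (rr (1 - a - b) n * (n:ℝ) ^ (1 - (1 - a - b)))) atTop
      (𝓝 (1 / Gamma (1 - a) * (1 / Gamma (1 - b)) * 1)) := by
    refine L2.congr' ?_
    filter_upwards [eventually_gt_atTop 0] with n hn
    have hn' : (0:ℝ) < n := by exact_mod_cast hn
    have e : (n:ℝ) ^ (1 - (1 - a - b)) = (n:ℝ) ^ (1 - (1 - a)) * (n:ℝ) ^ (1 - (1 - b)) := by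
      rw [← Real.rpow_add hn']; congr 1; ring
    rw [e]
    linear_combination -(n:ℝ) ^ (1 - (1 - a)) * (n:ℝ) ^ (1 - (1 - b)) * prod n
  have fin := tendsto_nhds_unique L1 this
  rw [← hS0]
  have g1 : Gamma (1 - a) ≠ 0 := (Gamma_pos_of_pos (by linarith)).ne'
  have g2 : Gamma (1 - b) ≠ 0 := (Gamma_pos_of_pos (by linarith)).ne'
  have g3 : Gamma (1 - a - b) ≠ 0 := (Gamma_pos_of_pos (by linarith)).ne'
  field_simp at fin ⊢
  linarith

/-- Abelian comparison of power series at `1`. -/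
lemma abel_compare {d b : ℕ → ℝ} {L : ℝ} (hd : PBd d) (hb : PBd b) (hb0 : ∀ n, 0 < b n)
    (hlim : Tendsto (fun n => d n / b n) atTop (𝓝 L))
    (hinf : Tendsto (psum b) (𝓝[<] 1) atTop) :
    Tendsto (fun y => psum d y / psum b y) (𝓝[<] 1) (𝓝 L) := by
  rw [Metric.tendsto_nhds]
  intro ε hε
  have h1 := (Metric.tendsto_atTop.1 hlim) (ε / 2) (by positivity)
  obtain ⟨N, hN⟩ := h1
  set K : ℝ := ∑ n ∈ Finset.range N, |d n - L * b n| with hK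
  have hK0 : 0 ≤ K := Finset.sum_nonneg fun _ _ => abs_nonneg _
  have ev : ∀ᶠ y in 𝓝[<] (1:ℝ), 0 < y ∧ y < 1 := by
    have : Set.Ioo (0:ℝ) 1 ∈ 𝓝[<] (1:ℝ) := Ioo_mem_nhdsLT (by norm_num)
    exact this
  filter_upwards [ev, hinf.eventually_gt_atTop (2 * K / ε), hinf.eventually_gt_atTop 0]
    with y hy hB hB0
  have hy1 : |y| < 1 := by rw [abs_of_pos hy.1]; exact hy.2
  have sd := hd.summable hy1
  have sb := hb.summable hy1
  rw [Real.dist_eq, div_sub' hB0.ne', abs_div, abs_of_pos hB0, div_lt_iff₀ hB0]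
  have e : psum d y - psum b y * L = ∑' n, (d n - L * b n) * y ^ n := by
    rw [psum, psum, mul_comm, ← tsum_mul_left, ← sd.tsum_sub (sb.mul_left L)]
    exact tsum_congr fun n => by ring
  have sabs : Summable (fun n => (d n - L * b n) * y ^ n) :=
    (sd.sub (sb.mul_left L)).congr fun n => by ring
  have sfin : HasSum (fun n => if n < N then |d n - L * b n| else 0) K := by
    have := hasSum_sum_of_ne_finset_zero (L := SummationFilter.unconditional ℕ) (f := fun n => if n < N then |d n - L * b n| else 0)
      (s := Finset.range N) (by intro n hn; simp at hn; simp [hn])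
    convert this using 1
    rw [hK]
    exact Finset.sum_congr rfl fun n hn => by rw [if_pos (Finset.mem_range.1 hn)]
  have bound : ∀ n, |(d n - L * b n) * y ^ n| ≤
      (ε / 2) * (b n * y ^ n) + (if n < N then |d n - L * b n| else 0) := by
    intro n
    have hyn : 0 < y ^ n := pow_pos hy.1 n
    have hyn1 : y ^ n ≤ 1 := pow_le_one₀ hy.1.le hy.2.le
    rw [abs_mul, abs_of_pos hyn]
    split_ifs with h
    · have := mul_le_mul_of_nonneg_left hyn1 (abs_nonneg (d n - L * b n))
      have h2 : 0 ≤ (ε / 2) * (b n * y ^ n) := by have := hb0 n; positivity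
      linarith
    · have h3 := hN n (not_lt.1 h)
      rw [Real.dist_eq, div_sub' (hb0 n).ne', abs_div, abs_of_pos (hb0 n),
        div_lt_iff₀ (hb0 n)] at h3
      rw [mul_comm (b n) L] at h3
      have := mul_le_mul_of_nonneg_right h3.le hyn.le
      linarith
  have stot := (sb.hasSum.mul_left (ε / 2)).add sfin
  have h5 : |∑' n, (d n - L * b n) * y ^ n| ≤ (ε / 2) * psum b y + K := by
    have h6 := norm_tsum_le_tsum_norm (f := fun n => (d n - L * b n) * y ^ n) sabs.norm
    refine h6.trans ?_
    have h7 := Summable.tsum_le_tsum (f := fun n => ‖(d n - L * b n) * y ^ n‖) bound sabs.norm stot.summable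
    rw [stot.tsum_eq] at h7
    exact h7
  rw [e]
  rw [div_lt_iff₀ hε] at hB
  linarith

lemma rr_bd {a : ℝ} (ha : 0 ≤ a) (ha1 : a ≤ 1) : PBd (rr a) := by
  refine ⟨1, 0, fun n => ?_⟩
  rw [abs_of_nonneg (rr_nonneg ha n)]
  simpa using rr_le_one ha ha1 n

lemma binom_sum {s : ℝ} (h0 : 0 ≤ s) (h1 : s ≤ 1) {y : ℝ} (hy : |y| < 1) :
    psum (rr s) y = (1 - y) ^ (-s) := by
  have hb := rr_bd h0 h1
  have ode : ∀ x : ℝ, |x| < 1 → (1 - x) * psum (Dc (rr s)) x = s * psum (rr s) x := by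
    intro x hx
    have s0 := (hb.summable hx).hasSum
    have s1 := (hb.dc.summable hx).hasSum
    have e1 := hasSum_shift (f := fun n : ℕ => (n:ℝ) * rr s n * x ^ n) (x := x) s1 (by simp)
      (fun n => by simp only [Dc]; push_cast; ring)
    have tot := (s1.sub e1).sub (s0.mul_left s)
    have z : HasSum (fun _ : ℕ => (0:ℝ)) 0 := hasSum_zero
    have := tot.unique (z.congr_fun ?_)
    · simp only [psum]
      linear_combination this
    · intro n
      have h := rr_succ s n
      have : (1:ℝ) + n ≠ 0 := by positivity
      field_simp at h
      simp only [Dc]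
      linear_combination x ^ n * h
  have der : ∀ x ∈ Set.Ioo (-1:ℝ) 1,
      HasDerivAt (fun x => psum (rr s) x * (1 - x) ^ s) 0 x := by
    intro x hx
    have hx' : |x| < 1 := abs_lt.2 hx
    have hpos : 0 < 1 - x := by linarith [hx.2]
    have d1 := hb.hasDerivAt hx'
    have d2 : HasDerivAt (fun x : ℝ => (1 - x) ^ s) (-1 * s * (1 - x) ^ (s - 1)) x :=
      ((hasDerivAt_id x).const_sub 1).rpow_const (Or.inl hpos.ne')
    refine (d1.mul d2).congr_deriv ?_
    have := ode x hx'
    rw [Real.rpow_sub hpos, Real.rpow_one]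
    field_simp
    linear_combination ((1 - x) ^ s) * this
  have hconst : psum (rr s) y * (1 - y) ^ s = psum (rr s) 0 * (1 - 0) ^ s := by
    refine (convex_Ioo (-1:ℝ) 1).is_const_of_fderivWithin_eq_zero (𝕜 := ℝ)
      (f := fun x => psum (rr s) x * (1 - x) ^ s)
      (fun x hx => (der x hx).differentiableAt.differentiableWithinAt) ?_ (abs_lt.1 hy) (by simp)
    intro x hx
    have := (der x hx).hasFDerivAt.hasFDerivWithinAt (s := Set.Ioo (-1:ℝ) 1)
    rw [this.fderivWithin (isOpen_Ioo.uniqueDiffWithinAt hx)]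
    ext; simp
  have h00 : psum (rr s) 0 = 1 := by
    rw [psum, tsum_eq_single 0 (by intro n hn; simp [hn])]
    simp [rr_zero]
  have hpos : 0 < 1 - y := by linarith [(abs_lt.1 hy).2]
  rw [h00] at hconst
  rw [Real.rpow_neg hpos.le, ← one_div, eq_div_iff (by positivity), hconst]
  simp

lemma h_lim_one {a b : ℝ} (ha : 0 < a) (hb : 0 < b) (hab : a + b < 1) :
    Tendsto (psum (hc a b)) (𝓝[<] 1) (𝓝 (∑' n, hc a b n)) :=
  Real.tendsto_tsum_powerSeries_nhdsWithin_lt (hc_summable ha hb hab).hasSum.tendsto_sum_nat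

lemma rr_pos {a : ℝ} (h : 0 < a) (n : ℕ) : 0 < rr a n :=
  Finset.prod_pos fun i _ => by positivity

lemma hd_lim_one :
    Tendsto (fun y => psum (Dc (hc (1/12) (7/12))) y * (1 - y) ^ (2/3:ℝ)) (𝓝[<] 1)
      (𝓝 (Gamma (2/3) / (Gamma (1/12) * Gamma (7/12)))) := by
  have key := abel_compare (d := Dc (hc (1/12) (7/12))) (b := rr (2/3))
    (L := Gamma (2/3) / (Gamma (1/12) * Gamma (7/12)))
    (hc_bd (by norm_num) (by norm_num) (by norm_num) (by norm_num)).dc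
    (rr_bd (by norm_num) (by norm_num)) (rr_pos (by norm_num)) ?_ ?_
  · refine key.congr' ?_
    have : Set.Ioo (0:ℝ) 1 ∈ 𝓝[<] (1:ℝ) := Ioo_mem_nhdsLT (by norm_num)
    filter_upwards [this] with y hy
    have hpos : 0 < 1 - y := by linarith [hy.2]
    rw [binom_sum (by norm_num) (by norm_num) (abs_lt.2 ⟨by linarith [hy.1], hy.2⟩),
      Real.rpow_neg hpos.le, div_inv_eq_mul]
  · have l1 := hc_tendsto (a := 1/12) (b := 7/12) (by norm_num) (by norm_num)
    have l2 := rr_tendsto (s := 2/3) (by norm_num)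
    have l3 : Tendsto (fun n : ℕ => (n:ℝ) / (n + 1)) atTop (𝓝 1) := tendsto_natCast_div_add_atTop 1
    have l4 : Tendsto (fun n : ℕ => (n:ℝ) / (n + 1/12)) atTop (𝓝 1) :=
      tendsto_natCast_div_add_atTop _
    have l5 : Tendsto (fun n : ℕ => (n:ℝ) / (n + 7/12)) atTop (𝓝 1) :=
      tendsto_natCast_div_add_atTop _
    have hG : (1:ℝ) / Gamma (2/3) ≠ 0 :=
      one_div_ne_zero (Gamma_pos_of_pos (by norm_num)).ne'
    have L := ((l1.mul l3).div (l4.mul l5) (by norm_num)).div l2 hG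
    have e : (1 / (Gamma (1/12) * Gamma (7/12)) * 1 / (1 * 1) / (1 / Gamma (2/3)) : ℝ)
        = Gamma (2/3) / (Gamma (1/12) * Gamma (7/12)) := by
      simp; ring
    rw [e] at L
    refine L.congr' ?_
    filter_upwards [eventually_gt_atTop 0] with n hn
    have hn' : (0:ℝ) < n := by exact_mod_cast hn
    have h1 : (n:ℝ) ^ (2 - 1/12 - 7/12 : ℝ) = n * (n:ℝ) ^ (1 - 2/3 : ℝ) := by
      rw [← Real.rpow_one_add' hn'.le (by norm_num)]; norm_num
    have hs := hc_succ (1/12) (7/12) n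
    have hs' : Dc (hc (1/12) (7/12)) n
        = (n + 1/12) * (n + 7/12) * hc (1/12) (7/12) n / (n + 1) := by
      rw [eq_div_iff (by positivity), Dc, ← hs]; ring
    rw [hs']
    simp only [Pi.div_apply]
    rw [h1]
    have := rr_pos (a := 2/3) (by norm_num) n
    have h3 : (0:ℝ) < (n:ℝ) ^ (1 - 2/3 : ℝ) := by positivity
    generalize (n:ℝ) ^ (1 - 2/3 : ℝ) = w at *
    field_simp
  · have : Tendsto (fun y : ℝ => (1 - y) ^ (-(2/3):ℝ)) (𝓝[<] 1) atTop := by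
      have t1 : Tendsto (fun y : ℝ => 1 - y) (𝓝[<] 1) (𝓝[>] 0) := by
        apply tendsto_nhdsWithin_of_tendsto_nhds_of_eventually_within
        · have : Tendsto (fun y : ℝ => 1 - y) (𝓝 1) (𝓝 (1 - 1)) :=
            (continuous_const.sub continuous_id).tendsto 1
          rw [sub_self] at this
          exact this.mono_left nhdsWithin_le_nhds
        · filter_upwards [self_mem_nhdsWithin] with y hy
          simpa using hy
      exact (tendsto_rpow_neg_nhdsGT_zero (by norm_num)).comp t1
    refine this.congr' ?_
    have : Set.Ioo (0:ℝ) 1 ∈ 𝓝[<] (1:ℝ) := Ioo_mem_nhdsLT (by norm_num)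
    filter_upwards [this] with y hy
    rw [binom_sum (by norm_num) (by norm_num) (abs_lt.2 ⟨by linarith [hy.1], hy.2⟩)]

lemma gamma_const :
    (∑' n, hc (1/12) (7/12) n) * (Gamma (2/3) / (Gamma (1/12) * Gamma (7/12)))
      = 1 / (2 * sqrt 3 * π) := by
  rw [gauss (by norm_num) (by norm_num) (by norm_num)]
  have r1 := Real.Gamma_mul_Gamma_one_sub (1/12)
  have r2 := Real.Gamma_mul_Gamma_one_sub (7/12)
  have r3 := Real.Gamma_mul_Gamma_one_sub (1/3)
  have c1 : (1:ℝ) - 1/12 - 7/12 = 1/3 := by norm_num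
  have c2 : (1:ℝ) - 1/3 = 2/3 := by norm_num
  rw [c1]
  rw [c2] at r3
  have s3 : sin (π * (1/3)) = sqrt 3 / 2 := by
    rw [mul_one_div, Real.sin_pi_div_three]
  have s12 : sin (π * (1/12)) * sin (π * (7/12)) = 1/4 := by
    have : π * (7/12) = π * (1/12) + π / 2 := by ring
    rw [this, Real.sin_add_pi_div_two]
    have h2 := Real.sin_two_mul (π * (1/12))
    have : 2 * (π * (1/12)) = π / 6 := by ring
    rw [this, Real.sin_pi_div_six] at h2
    linarith
  have hs1 : sin (π * (1/12)) ≠ 0 := by intro h; rw [h] at s12; norm_num at s12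
  have hs2 : sin (π * (7/12)) ≠ 0 := by intro h; rw [h] at s12; norm_num at s12
  have hs4 : sqrt 3 ≠ 0 := by positivity
  have hs5 : sqrt 3 * sqrt 3 = 3 := Real.mul_self_sqrt (by norm_num)
  have hpi := Real.pi_ne_zero
  have e : Gamma (1/3) / (Gamma (1 - 1/12) * Gamma (1 - 7/12)) *
      (Gamma (2/3) / (Gamma (1/12) * Gamma (7/12)))
      = (Gamma (1/3) * Gamma (2/3)) / ((Gamma (1/12) * Gamma (1 - 1/12)) *
        (Gamma (7/12) * Gamma (1 - 7/12))) := by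
    rw [div_mul_div_comm]; congr 1; ring
  rw [e, r1, r2, r3, s3, div_mul_div_comm, s12]
  field_simp
  try norm_num

open PowerSeries in
/-- `θ = X d/dX` on formal power series -/
noncomputable def thetaPS (f : PowerSeries ℝ) : PowerSeries ℝ := X * derivative ℝ f

open PowerSeries in
lemma coeff_theta (f : PowerSeries ℝ) (n : ℕ) : coeff n (thetaPS f) = n * coeff n f := by
  rw [thetaPS]
  cases n with
  | zero => simp
  | succ k => rw [coeff_succ_X_mul, coeff_derivative]; push_cast; ring

open PowerSeries in
lemma theta_mul (f g : PowerSeries ℝ) : thetaPS (f * g) = thetaPS f * g + f * thetaPS g := by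
  simp only [thetaPS, Derivation.leibniz, smul_eq_mul]; ring

lemma theta_add (f g : PowerSeries ℝ) : thetaPS (f + g) = thetaPS f + thetaPS g := by
  simp only [thetaPS, map_add]; ring

open PowerSeries in
lemma clausen_coeff (n : ℕ) :
    ∑ p ∈ Finset.HasAntidiagonal.antidiagonal n, hc (1/12) (5/12) p.1 * hc (1/12) (5/12) p.2
      = rr (1/2) n * rr (1/6) n * rr (5/6) n := by
  set φ : PowerSeries ℝ := PowerSeries.mk (hc (1/12) (5/12)) with hφ
  have tX : thetaPS (X : PowerSeries ℝ) = X := by simp [thetaPS]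
  have tC : ∀ r : ℝ, thetaPS (C r : PowerSeries ℝ) = 0 := by intro r; simp [thetaPS]
  have ode : thetaPS (thetaPS φ) = X * (thetaPS (thetaPS φ) + C (1/2) * thetaPS φ + C (5/144) * φ) := by
    ext k
    cases k with
    | zero => simp [coeff_theta]
    | succ k =>
      rw [coeff_succ_X_mul]
      simp only [map_add, coeff_C_mul, coeff_theta, hφ, coeff_mk]
      have := hc_succ (1/12) (5/12) k
      push_cast
      linear_combination this
  have ode2 := congrArg thetaPS ode
  simp only [theta_mul, theta_add, tX, tC] at ode2
  have y1 : thetaPS (φ * φ) = 2 * (φ * thetaPS φ) := by rw [theta_mul]; ring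
  have y2 : thetaPS (thetaPS (φ * φ)) = 2 * (thetaPS φ * thetaPS φ + φ * thetaPS (thetaPS φ)) := by
    rw [theta_mul, theta_add, theta_mul, theta_mul]; ring
  have y3 : thetaPS (thetaPS (thetaPS (φ * φ))) = 6 * (thetaPS φ * thetaPS (thetaPS φ))
      + 2 * (φ * thetaPS (thetaPS (thetaPS φ))) := by
    simp only [theta_mul, theta_add]; ring
  have c1 : (C (1/2) : PowerSeries ℝ) = 72 * C (1/144) := by
    rw [show (72 : PowerSeries ℝ) = C 72 from rfl, ← map_mul]; norm_num
  have c2 : (C (5/144) : PowerSeries ℝ) = 5 * C (1/144) := by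
    rw [show (5 : PowerSeries ℝ) = C 5 from rfl, ← map_mul]; norm_num
  have c3 : (C (3/2) : PowerSeries ℝ) = 216 * C (1/144) := by
    rw [show (216 : PowerSeries ℝ) = C 216 from rfl, ← map_mul]; norm_num
  have c4 : (C (23/36) : PowerSeries ℝ) = 92 * C (1/144) := by
    rw [show (92 : PowerSeries ℝ) = C 92 from rfl, ← map_mul]; norm_num
  have c5 : (C (5/72) : PowerSeries ℝ) = 10 * C (1/144) := by
    rw [show (10 : PowerSeries ℝ) = C 10 from rfl, ← map_mul]; norm_num
  have c6 : (1 : PowerSeries ℝ) = 144 * C (1/144) := by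
    rw [show (144 : PowerSeries ℝ) = C 144 from rfl, ← map_mul]; norm_num
  have ode3 : thetaPS (thetaPS (thetaPS (φ * φ))) = X * (thetaPS (thetaPS (thetaPS (φ * φ))) +
      C (3/2) * thetaPS (thetaPS (φ * φ)) + C (23/36) * thetaPS (φ * φ) + C (5/72) * (φ * φ)) := by
    rw [y3, y2, y1, c3, c4, c5]
    rw [c1, c2] at ode ode2
    linear_combination 6 * thetaPS φ * ode + 2 * φ * ode2 + 
      (2 * φ * thetaPS (thetaPS φ) * X) * c6
  have recur : ∀ k : ℕ, ((k:ℝ) + 1) ^ 3 * coeff (k + 1) (φ * φ)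
      = (k + 1/2) * (k + 1/6) * (k + 5/6) * (coeff k (φ * φ)) := by
    intro k
    have := congrArg (coeff (k + 1)) ode3
    rw [coeff_succ_X_mul] at this
    simp only [map_add, coeff_C_mul, coeff_theta] at this
    push_cast at this
    linear_combination this
  have fin : ∀ k : ℕ, coeff k (φ * φ) = rr (1/2) k * rr (1/6) k * rr (5/6) k := by
    intro k
    induction k with
    | zero => simp [hφ, rr_zero, hc_zero]
    | succ k ih =>
      have h := recur k
      rw [ih] at h
      have hk : (1:ℝ) + k ≠ 0 := by positivity
      have hk' : ((k:ℝ) + 1) ^ 3 ≠ 0 := by positivity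
      rw [rr_succ, rr_succ, rr_succ]
      apply mul_left_cancel₀ hk'
      rw [h]
      field_simp
      ring
  rw [← fin n, coeff_mul]
  simp [hφ]

/-- coefficients of the `₃F₂` -/
noncomputable def cl (n : ℕ) : ℝ := rr (1/2) n * rr (1/6) n * rr (5/6) n

lemma cl_bd : PBd cl := by
  refine ⟨1, 0, fun n => ?_⟩
  have h1 := rr_nonneg (a := 1/2) (by norm_num) n
  have h2 := rr_nonneg (a := 1/6) (by norm_num) n
  have h3 := rr_nonneg (a := 5/6) (by norm_num) n
  have h4 := rr_le_one (a := 1/2) (by norm_num) (by norm_num) n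
  have h5 := rr_le_one (a := 1/6) (by norm_num) (by norm_num) n
  have h6 := rr_le_one (a := 5/6) (by norm_num) (by norm_num) n
  rw [cl, abs_of_nonneg (by positivity)]
  rw [pow_zero, mul_one]
  exact mul_le_one₀ (mul_le_one₀ h4 h2 h5) h3 h6

lemma clausen {z : ℝ} (hz : |z| < 1) : psum (hc (1/12) (5/12)) z ^ 2 = psum cl z := by
  have hb := hc_bd (a := 1/12) (b := 5/12) (by norm_num) (by norm_num) (by norm_num) (by norm_num)
  have s := (hb.summable hz).norm
  rw [pow_two, psum, tsum_mul_tsum_eq_tsum_sum_antidiagonal_of_summable_norm s s, psum]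
  refine tsum_congr fun n => ?_
  rw [cl, ← clausen_coeff, Finset.sum_mul]
  refine Finset.sum_congr rfl fun p hp => ?_
  rw [← Finset.HasAntidiagonal.mem_antidiagonal.1 hp, pow_add]; ring

lemma pull {a b : ℝ} (ha : 0 ≤ a) (ha1 : a ≤ 1) (hb : 0 ≤ b) (hb1 : b ≤ 1)
    {m μ z zd : ℝ → ℝ} {μd zdd R x : ℝ}
    (hm : HasDerivAt m (μ x * m x) x) (hμ : HasDerivAt μ μd x) (hz : HasDerivAt z (zd x) x)
    (hzd : HasDerivAt zd zdd x) (hx : |z x| < 1)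
    (i2 : x * (1 - x) * zd x ^ 2 = R * (z x * (1 - z x)))
    (i1 : (1 - 2 * x) * zd x + x * (1 - x) * (2 * μ x * zd x + zdd)
      = R * (1 - (a + b + 1) * z x))
    (i0 : (1 - 2 * x) * μ x + x * (1 - x) * (μ x ^ 2 + μd) + R * (a * b) = 2 / 9) :
    HasDerivAt (fun x => m x * psum (hc a b) (z x))
      (m x * (μ x * psum (hc a b) (z x) + zd x * psum (Dc (hc a b)) (z x))) x ∧
    HasDerivAt (fun x => x * (1 - x) *
      (m x * (μ x * psum (hc a b) (z x) + zd x * psum (Dc (hc a b)) (z x))))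
      (2 / 9 * (m x * psum (hc a b) (z x))) x := by
  have hbd := hc_bd ha ha1 hb hb1
  have d0 : HasDerivAt (fun x => psum (hc a b) (z x)) (psum (Dc (hc a b)) (z x) * zd x) x :=
    (hbd.hasDerivAt hx).comp x hz
  have d1 : HasDerivAt (fun x => psum (Dc (hc a b)) (z x))
      (psum (Dc (Dc (hc a b))) (z x) * zd x) x := (hbd.dc.hasDerivAt hx).comp x hz
  have ode := hyp_ode ha ha1 hb hb1 hx
  have dp : HasDerivAt (fun x : ℝ => x * (1 - x)) (1 - 2 * x) x := by
    refine ((hasDerivAt_id x).mul ((hasDerivAt_id x).const_sub 1)).congr_deriv ?_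
    simp; ring
  refine ⟨(hm.mul d0).congr_deriv (by ring), ?_⟩
  refine (dp.mul (hm.mul ((hμ.mul d0).add (hzd.mul d1)))).congr_deriv ?_
  simp only [Pi.add_apply, Pi.mul_apply]
  linear_combination m x * R * ode + m x * psum (Dc (Dc (hc a b))) (z x) * i2
    + m x * psum (Dc (hc a b)) (z x) * i1 + m x * psum (hc a b) (z x) * i0

noncomputable def z3 (x : ℝ) : ℝ := 64 * x ^ 3 * (1 - x) / (9 - 8 * x) ^ 3
noncomputable def z3d (x : ℝ) : ℝ := 64 * x ^ 2 * (27 - 36 * x + 8 * x ^ 2) / (9 - 8 * x) ^ 4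
noncomputable def m1 (x : ℝ) : ℝ := (1 - 8 * x / 9) ^ (-(1/4) : ℝ)
noncomputable def mu1 (x : ℝ) : ℝ := 2 / (9 - 8 * x)
noncomputable def qq (x : ℝ) : ℝ := 1 - 20 * x - 8 * x ^ 2
noncomputable def yy (x : ℝ) : ℝ := -64 * x * (1 - x) ^ 3 / qq x ^ 2
noncomputable def yyd (x : ℝ) : ℝ := -64 * (1 - x) ^ 2 * (1 + 8 * x) ^ 2 / qq x ^ 3
noncomputable def m2 (x : ℝ) : ℝ := qq x ^ (-(1/6) : ℝ)
noncomputable def mu2 (x : ℝ) : ℝ := (20 + 16 * x) / (6 * qq x)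

noncomputable def uu (x : ℝ) : ℝ := m1 x * psum (hc (1/12) (5/12)) (z3 x)
noncomputable def uud (x : ℝ) : ℝ :=
  m1 x * (mu1 x * psum (hc (1/12) (5/12)) (z3 x) + z3d x * psum (Dc (hc (1/12) (5/12))) (z3 x))
noncomputable def vv (x : ℝ) : ℝ := m2 x * psum (hc (1/12) (7/12)) (yy x)
noncomputable def vvd (x : ℝ) : ℝ :=
  m2 x * (mu2 x * psum (hc (1/12) (7/12)) (yy x) + yyd x * psum (Dc (hc (1/12) (7/12))) (yy x))

lemma z3_abs {x : ℝ} (h1 : -1/8 ≤ x) (h2 : x < 1/1000) : |z3 x| < 1 := by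
  have hp : (1:ℝ) < (9 - 8 * x) ^ 3 := one_lt_pow₀ (by linarith) (by norm_num)
  rw [z3, abs_div, abs_of_pos (by linarith : (0:ℝ) < (9 - 8 * x) ^ 3), div_lt_one (by linarith)]
  refine lt_of_le_of_lt ?_ hp
  rw [abs_mul, abs_mul, abs_pow]
  have ha : |x| ≤ 1/8 := abs_le.2 ⟨by linarith, by linarith⟩
  have hb : |1 - x| ≤ 2 := abs_le.2 ⟨by linarith, by linarith⟩
  have hc' : |x| ^ 3 ≤ (1/8) ^ 3 := pow_le_pow_left₀ (abs_nonneg x) ha 3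
  have h64 : |(64:ℝ)| = 64 := by norm_num
  rw [h64]
  calc 64 * |x| ^ 3 * |1 - x| ≤ 64 * (1/8) ^ 3 * 2 := by gcongr
    _ ≤ 1 := by norm_num

lemma qq_pos {x : ℝ} (h1 : -1/8 ≤ x) (h2 : x < 1/1000) : 1/2 < qq x := by
  rw [qq]; nlinarith

lemma one_sub_yy {x : ℝ} (h1 : -1/8 ≤ x) (h2 : x < 1/1000) :
    1 - yy x = (1 + 8 * x) ^ 3 / qq x ^ 2 := by
  have := qq_pos h1 h2
  rw [yy, eq_div_iff (by positivity), sub_mul, div_mul_cancel₀ _ (by positivity), qq]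
  ring

lemma yy_abs {x : ℝ} (h1 : -1/8 < x) (h2 : x < 1/1000) : |yy x| < 1 := by
  have hq := qq_pos h1.le h2
  rw [abs_lt]
  constructor
  · rw [yy, lt_div_iff₀ (by positivity)]
    rcases le_or_gt x 0 with h | h
    · have : 0 ≤ -64 * x * (1 - x) ^ 3 := by
        have : 0 ≤ 1 - x := by linarith
        have : 0 ≤ -x := by linarith
        have : 0 ≤ 64 * (-x) * (1 - x) ^ 3 := by positivity
        linarith
      have : 0 < qq x ^ 2 := by positivity
      linarith
    · have h3 : (1 - x) ^ 3 ≤ 1 := pow_le_one₀ (by linarith) (by linarith)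
      have h4 : x * (1 - x) ^ 3 ≤ x := by nlinarith
      have h5 : 1/4 < qq x ^ 2 := by nlinarith
      nlinarith
  · have e := one_sub_yy h1.le h2
    have : 0 < (1 + 8 * x) ^ 3 / qq x ^ 2 := by
      have : 0 < 1 + 8 * x := by linarith
      positivity
    linarith

lemma hasDerivAt_qq (x : ℝ) : HasDerivAt qq (-20 - 16 * x) x := by
  have h : HasDerivAt (fun x : ℝ => 1 - 20 * x - 8 * x ^ 2) (0 - 20 * 1 - 8 * (2 * x ^ 1 * 1)) x :=
    ((hasDerivAt_const x (1:ℝ)).sub ((hasDerivAt_id x).const_mul 20)).sub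
      (((hasDerivAt_id x).pow 2).const_mul 8)
  exact h.congr_deriv (by ring)

lemma u_pull {x : ℝ} (h1 : -1/8 ≤ x) (h2 : x < 1/1000) :
    HasDerivAt uu (uud x) x ∧ HasDerivAt (fun x => x * (1 - x) * uud x) (2 / 9 * uu x) x := by
  have hne : (9:ℝ) - 8 * x ≠ 0 := by linarith
  have hpos : (0:ℝ) < 1 - 8 * x / 9 := by linarith
  have dl : HasDerivAt (fun x : ℝ => 9 - 8 * x) (-8) x :=
    (((hasDerivAt_id x).const_mul 8).const_sub 9).congr_deriv (by ring)
  refine pull (a := 1/12) (b := 5/12) (m := m1) (μ := mu1) (z := z3) (zd := z3d)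
    (μd := 16 / (9 - 8 * x) ^ 2)
    (zdd := (64 * (54 * x - 108 * x ^ 2 + 32 * x ^ 3) * (9 - 8 * x)
      + 64 * x ^ 2 * (27 - 36 * x + 8 * x ^ 2) * 32) / (9 - 8 * x) ^ 5)
    (R := 64 * x ^ 2 / (9 - 8 * x) ^ 2)
    (by norm_num) (by norm_num) (by norm_num) (by norm_num) ?_ ?_ ?_ ?_ (z3_abs h1 h2) ?_ ?_ ?_
  · have d : HasDerivAt (fun x : ℝ => 1 - 8 * x / 9) (-(8/9)) x :=
      ((((hasDerivAt_id x).const_mul 8).div_const 9).const_sub 1).congr_deriv (by ring)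
    refine (d.rpow_const (p := -(1/4)) (Or.inl hpos.ne')).congr_deriv ?_
    rw [Real.rpow_sub hpos, Real.rpow_one, mu1, m1]
    have e : (9:ℝ) - 8 * x = 9 * (1 - 8 * x / 9) := by ring
    rw [e]
    field_simp
    ring
  · refine ((hasDerivAt_const x (2:ℝ)).div dl hne).congr_deriv ?_
    field_simp
    ring
  · have n : HasDerivAt (fun x : ℝ => 64 * x ^ 3 * (1 - x)) (64 * (3 * x ^ 2) * (1 - x) + 64 * x ^ 3 * (-1)) x :=
      ((hasDerivAt_pow 3 x).const_mul 64).mul ((hasDerivAt_id x).const_sub 1)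
    refine (n.div (dl.pow 3) (pow_ne_zero 3 hne)).congr_deriv ?_
    rw [z3d]
    simp only [Pi.pow_apply]
    push_cast
    field_simp
    ring
  · have n : HasDerivAt (fun x : ℝ => 64 * x ^ 2 * (27 - 36 * x + 8 * x ^ 2))
        (64 * (2 * x ^ 1) * (27 - 36 * x + 8 * x ^ 2) + 64 * x ^ 2 * (-(36 * 1) + 8 * (2 * x ^ 1))) x :=
      ((hasDerivAt_pow 2 x).const_mul 64).mul
        ((((hasDerivAt_id x).const_mul 36).const_sub 27).add ((hasDerivAt_pow 2 x).const_mul 8))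
    refine (n.div (dl.pow 4) (pow_ne_zero 4 hne)).congr_deriv ?_
    simp only [Pi.pow_apply]
    push_cast
    field_simp
    ring
  · rw [z3, z3d]; generalize hL : 9 - 8 * x = L at hne ⊢; have hxL : x = (9 - L) / 8 := by linarith
    subst hxL; field_simp; ring
  · rw [z3, z3d, mu1]; generalize hL : 9 - 8 * x = L at hne ⊢; have hxL : x = (9 - L) / 8 := by linarith
    subst hxL; field_simp; ring
  · rw [mu1]; generalize hL : 9 - 8 * x = L at hne ⊢; have hxL : x = (9 - L) / 8 := by linarith
    subst hxL; field_simp; ring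

lemma v_pull {x : ℝ} (h1 : -1/8 < x) (h2 : x < 1/1000) :
    HasDerivAt vv (vvd x) x ∧ HasDerivAt (fun x => x * (1 - x) * vvd x) (2 / 9 * vv x) x := by
  have hq := qq_pos h1.le h2
  have hpos : 0 < qq x := by linarith
  have hne : qq x ≠ 0 := hpos.ne'
  have dq := hasDerivAt_qq x
  have hqe : qq x = 1 - 20 * x - 8 * x ^ 2 := rfl
  refine pull (a := 1/12) (b := 7/12) (m := m2) (μ := mu2) (z := yy) (zd := yyd)
    (μd := (16 * qq x + (20 + 16 * x) ^ 2) / (6 * qq x ^ 2))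
    (zdd := (-128 * (1 - x) * (1 + 8 * x) * (7 - 16 * x) * qq x
      - 3 * 64 * (1 - x) ^ 2 * (1 + 8 * x) ^ 2 * (20 + 16 * x)) / qq x ^ 4)
    (R := -64 * (1 - x) ^ 2 * (1 + 8 * x) / qq x ^ 2)
    (by norm_num) (by norm_num) (by norm_num) (by norm_num) ?_ ?_ ?_ ?_ (yy_abs h1 h2) ?_ ?_ ?_
  · refine (dq.rpow_const (p := -(1/6)) (Or.inl hne)).congr_deriv ?_
    rw [Real.rpow_sub hpos, Real.rpow_one, mu2, m2]
    field_simp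
    ring
  · have n : HasDerivAt (fun x : ℝ => 20 + 16 * x) (16 * 1) x :=
      ((hasDerivAt_id x).const_mul 16).const_add 20
    refine (n.div (dq.const_mul 6) (by positivity)).congr_deriv ?_
    field_simp
    ring
  · have n : HasDerivAt (fun x : ℝ => -64 * x * (1 - x) ^ 3)
        (-64 * 1 * (1 - x) ^ 3 + -64 * x * (3 * (1 - x) ^ 2 * (-1))) x :=
      ((hasDerivAt_id x).const_mul (-64)).mul (((hasDerivAt_id x).const_sub 1).pow 3)
    refine (n.div (dq.pow 2) (pow_ne_zero 2 hne)).congr_deriv ?_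
    rw [yyd]
    simp only [Pi.pow_apply]
    push_cast
    field_simp
    rw [hqe]
    ring
  · have n : HasDerivAt (fun x : ℝ => -64 * (1 - x) ^ 2 * (1 + 8 * x) ^ 2)
        (-64 * (2 * (1 - x) ^ 1 * (-1)) * (1 + 8 * x) ^ 2
          + -64 * (1 - x) ^ 2 * (2 * (1 + 8 * x) ^ 1 * (8 * 1))) x :=
      ((((hasDerivAt_id x).const_sub 1).pow 2).const_mul (-64)).mul
        ((((hasDerivAt_id x).const_mul 8).const_add 1).pow 2)
    refine (n.div (dq.pow 3) (pow_ne_zero 3 hne)).congr_deriv ?_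
    simp only [Pi.pow_apply]
    push_cast
    field_simp
    ring
  · rw [yy, yyd]; field_simp; rw [hqe]; ring
  · rw [yy, yyd, mu2]; field_simp; rw [hqe]; ring
  · rw [mu2]; field_simp; rw [hqe]; ring

lemma psum_zero (c : ℕ → ℝ) : psum c 0 = c 0 := by
  rw [psum, tsum_eq_single 0 (by intro n hn; simp [hn])]
  simp

lemma uu_zero : uu 0 = 1 := by
  simp [uu, m1, z3, psum_zero, hc_zero]

lemma vv_zero : vv 0 = 1 := by
  simp [vv, m2, yy, qq, psum_zero, hc_zero]

lemma vv_pos {x : ℝ} (h1 : -1/8 < x) (h2 : x ≤ 0) : 0 < vv x := by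
  have h2' : x < 1/1000 := by linarith
  have hq := qq_pos h1.le h2'
  have hm : 0 < m2 x := Real.rpow_pos_of_pos (by linarith) _
  refine mul_pos hm ?_
  have hy : 0 ≤ yy x := by
    have : 0 ≤ 1 - x := by linarith
    have : 0 ≤ -x := by linarith
    have : 0 ≤ 64 * (-x) * (1 - x) ^ 3 := by positivity
    rw [yy]
    apply div_nonneg _ (by positivity)
    linarith
  have hbd := hc_bd (a := 1/12) (b := 7/12) (by norm_num) (by norm_num) (by norm_num) (by norm_num)
  have := (hbd.summable (yy_abs h1 h2')).le_tsum 0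
    (fun n _ => mul_nonneg (hc_nonneg (by norm_num) (by norm_num) n) (pow_nonneg hy n))
  simp only [hc_zero, pow_zero, mul_one] at this
  exact lt_of_lt_of_le one_pos this

lemma wronskian {x : ℝ} (h1 : -1/8 < x) (h2 : x ≤ 0) :
    x * (1 - x) * uud x * vv x - x * (1 - x) * vvd x * uu x = 0 := by
  set W : ℝ → ℝ := fun x => x * (1 - x) * uud x * vv x - x * (1 - x) * vvd x * uu x with hW
  have der : ∀ t ∈ Set.Ioo (-1/8:ℝ) (1/1000), HasDerivAt W 0 t := by
    intro t ht
    obtain ⟨a1, a2⟩ := u_pull ht.1.le ht.2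
    obtain ⟨b1, b2⟩ := v_pull ht.1 ht.2
    refine ((a2.mul b1).sub (b2.mul a1)).congr_deriv ?_
    ring
  have : W x = W 0 := by
    refine (convex_Ioo (-1/8:ℝ) (1/1000)).is_const_of_fderivWithin_eq_zero (𝕜 := ℝ) (f := W)
      (fun t ht => (der t ht).differentiableAt.differentiableWithinAt) ?_
      ⟨h1, by linarith⟩ ⟨by norm_num, by norm_num⟩
    intro t ht
    have := (der t ht).hasFDerivAt.hasFDerivWithinAt (s := Set.Ioo (-1/8:ℝ) (1/1000))
    rw [this.fderivWithin (isOpen_Ioo.uniqueDiffWithinAt ht)]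
    ext; simp
  have h0 : W 0 = 0 := by simp [hW]
  exact this.trans h0

lemma uu_eq_vv {x : ℝ} (h1 : -1/8 < x) (h2 : x < 0) : uu x = vv x ∧ uud x = vvd x := by
  have der : ∀ t, -1/8 < t → t ≤ 0 →
      HasDerivAt (fun x => uu x / vv x) ((uud t * vv t - uu t * vvd t) / vv t ^ 2) t := by
    intro t ht1 ht2
    exact (u_pull ht1.le (by linarith)).1.div (v_pull ht1 (by linarith)).1 (vv_pos ht1 ht2).ne'
  have w0 : ∀ t, -1/8 < t → t < 0 → uud t * vv t - uu t * vvd t = 0 := by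
    intro t ht1 ht2
    have w := wronskian ht1 ht2.le
    have hne : t * (1 - t) ≠ 0 := mul_ne_zero ht2.ne (by linarith)
    apply mul_left_cancel₀ hne
    linear_combination w
  have hq : uu x / vv x = uu 0 / vv 0 := by
    have := constant_of_derivWithin_zero (f := fun x => uu x / vv x) (a := x) (b := 0)
      (fun t ht => (der t (by linarith [ht.1]) ht.2).differentiableAt.differentiableWithinAt)
      (fun t ht => by
        have ht0 : -1/8 < t := by linarith [ht.1]
        rw [(der t ht0 ht.2.le).hasDerivWithinAt.derivWithin
          ((uniqueDiffOn_Icc h2) t ⟨ht.1, ht.2.le⟩), w0 t ht0 ht.2, zero_div])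
    exact (this 0 ⟨h2.le, le_refl _⟩).symm
  rw [uu_zero, vv_zero, div_one, div_eq_one_iff_eq (vv_pos h1 h2.le).ne'] at hq
  refine ⟨hq, ?_⟩
  have w := w0 x h1 h2
  rw [hq] at w
  apply mul_left_cancel₀ (vv_pos h1 h2.le).ne'
  linear_combination w

lemma yy_tendsto : Tendsto yy (𝓝[>] (-1/8)) (𝓝[<] 1) := by
  have hq : qq (-1/8) = 27/8 := by norm_num [qq]
  have cq : ContinuousAt qq (-1/8) := (hasDerivAt_qq _).continuousAt
  have c : ContinuousAt yy (-1/8) := by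
    unfold yy
    refine ContinuousAt.div (by fun_prop) (cq.pow 2) ?_
    rw [hq]; norm_num
  have hv : yy (-1/8) = 1 := by rw [yy, hq]; norm_num
  refine tendsto_nhdsWithin_iff.2 ⟨?_, ?_⟩
  · have := c.tendsto
    rw [hv] at this
    exact this.mono_left nhdsWithin_le_nhds
  · have : Set.Ioo (-1/8:ℝ) (1/1000) ∈ 𝓝[>] (-1/8:ℝ) := Ioo_mem_nhdsGT (by norm_num)
    filter_upwards [this] with x hx
    exact (abs_lt.1 (yy_abs hx.1 hx.2)).2

lemma lhs_eq {x : ℝ} (h1 : -1/8 < x) (h2 : x < 0) :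
    uu x * (uud x - mu2 x * uu x) = psum (hc (1/12) (7/12)) (yy x) *
      (psum (Dc (hc (1/12) (7/12))) (yy x) * (1 - yy x) ^ (2/3:ℝ)) *
      (-64 * (1 - x) ^ 2 / qq x ^ 2) := by
  obtain ⟨e1, e2⟩ := uu_eq_vv h1 h2
  have h2' : x < 1/1000 := by linarith
  have hq := qq_pos h1.le h2'
  have hpos : 0 < qq x := by linarith
  have h8 : 0 < 1 + 8 * x := by linarith
  rw [e1, e2, vv, vvd, one_sub_yy h1.le h2', yyd]
  have r1 : ((1 + 8 * x) ^ 3 / qq x ^ 2) ^ (2/3:ℝ) = (1 + 8 * x) ^ 2 * qq x ^ (-(4/3):ℝ) := by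
    rw [Real.div_rpow (by positivity) (by positivity), ← Real.rpow_natCast, ← Real.rpow_natCast,
      ← Real.rpow_mul h8.le, ← Real.rpow_mul hpos.le, Real.rpow_neg hpos.le, ← Real.rpow_natCast]
    norm_num [div_eq_mul_inv]
  have r2 : m2 x * m2 x = qq x ^ (-(4/3):ℝ) * qq x := by
    rw [m2, ← Real.rpow_add hpos, ← Real.rpow_add_one hpos.ne']
    norm_num
  rw [r1]
  have hne := hpos.ne'
  have key : m2 x * psum (hc (1/12) (7/12)) (yy x) *
      (m2 x * (mu2 x * psum (hc (1/12) (7/12)) (yy x) + -64 * (1 - x) ^ 2 * (1 + 8 * x) ^ 2 / qq x ^ 3 * psum (Dc (hc (1/12) (7/12))) (yy x)) -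
      mu2 x * (m2 x * psum (hc (1/12) (7/12)) (yy x))) = (m2 x * m2 x) *
      (psum (hc (1/12) (7/12)) (yy x) * psum (Dc (hc (1/12) (7/12))) (yy x)) * (-64 * (1 - x) ^ 2 * (1 + 8 * x) ^ 2 / qq x ^ 3) := by ring
  rw [key, r2]
  field_simp

lemma boundary : uu (-1/8) * (uud (-1/8) - 8/9 * uu (-1/8)) = -32 / (9 * Real.sqrt 3 * π) := by
  have hq : qq (-1/8) = 27/8 := by norm_num [qq]
  have cq : ContinuousAt qq (-1/8) := (hasDerivAt_qq _).continuousAt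
  obtain ⟨d1, d2⟩ := u_pull (x := -1/8) (by norm_num) (by norm_num)
  have cu : ContinuousAt uu (-1/8) := d1.continuousAt
  have cud : ContinuousAt uud (-1/8) := by
    have c : ContinuousAt (fun x : ℝ => (x * (1 - x) * uud x) / (x * (1 - x))) (-1/8) :=
      ContinuousAt.div d2.continuousAt (by fun_prop) (by norm_num)
    refine c.congr ?_
    filter_upwards [Iio_mem_nhds (show (-1/8:ℝ) < 0 by norm_num)] with x hx
    have hx' : x < 0 := hx
    rw [mul_div_cancel_left₀]
    exact mul_ne_zero hx'.ne (by linarith)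
  have cm : ContinuousAt mu2 (-1/8) := by
    unfold mu2
    refine ContinuousAt.div (by fun_prop) (by fun_prop) ?_
    rw [hq]; norm_num
  have hm : mu2 (-1/8) = 8/9 := by rw [mu2, hq]; norm_num
  have L : Tendsto (fun x => uu x * (uud x - mu2 x * uu x)) (𝓝[>] (-1/8))
      (𝓝 (uu (-1/8) * (uud (-1/8) - mu2 (-1/8) * uu (-1/8)))) :=
    (cu.mul (cud.sub (cm.mul cu))).tendsto.mono_left nhdsWithin_le_nhds
  have cr : ContinuousAt (fun x : ℝ => -64 * (1 - x) ^ 2 / qq x ^ 2) (-1/8) := by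
    refine ContinuousAt.div (by fun_prop) (cq.pow 2) ?_
    rw [hq]; norm_num
  have R := (((h_lim_one (a := 1/12) (b := 7/12) (by norm_num) (by norm_num)
    (by norm_num)).comp yy_tendsto).mul (hd_lim_one.comp yy_tendsto)).mul
    (cr.tendsto.mono_left (nhdsWithin_le_nhds (s := Set.Ioi (-1/8))))
  have R2 := L.congr' (by
    have : Set.Ioo (-1/8:ℝ) 0 ∈ 𝓝[>] (-1/8:ℝ) := Ioo_mem_nhdsGT (by norm_num)
    filter_upwards [this] with x hx
    exact lhs_eq hx.1 hx.2)
  have := tendsto_nhds_unique R2 R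
  rw [gamma_const, hm, hq] at this
  rw [this]
  have := Real.pi_pos
  have : 0 < Real.sqrt 3 := by positivity
  field_simp
  norm_num

noncomputable def F0 : ℝ := psum (hc (1/12) (5/12)) (-9/64000)
noncomputable def F0d : ℝ := psum (Dc (hc (1/12) (5/12))) (-9/64000)

lemma main_value : F0 * (31 * F0 + 1012 * (-9/64000) * F0d) = 160 * Real.sqrt 30 / (9 * π) := by
  have b := boundary
  have e1 : z3 (-1/8) = -9/64000 := by norm_num [z3]
  have e2 : z3d (-1/8) = 253/80000 := by norm_num [z3d]
  have e3 : mu1 (-1/8) = 1/5 := by norm_num [mu1]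
  have e4 : m1 (-1/8) ^ 2 = 3 / Real.sqrt 10 := by
    rw [m1, ← Real.rpow_natCast, ← Real.rpow_mul (by norm_num)]
    have : (1 - 8 * (-1/8) / 9 : ℝ) = 10/9 := by norm_num
    rw [this]
    have : (-(1/4) * ((2:ℕ):ℝ) : ℝ) = -(1/2) := by norm_num
    rw [this, Real.rpow_neg (by norm_num), ← Real.sqrt_eq_rpow, Real.sqrt_div (by norm_num)]
    have : Real.sqrt 9 = 3 := by
      rw [show (9:ℝ) = 3 ^ 2 by norm_num, Real.sqrt_sq (by norm_num)]
    rw [this, inv_div]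
  rw [uu, uud, e1, e2, e3] at b
  change m1 (-1/8) * F0 * (m1 (-1/8) * (1/5 * F0 + 253/80000 * F0d) - 8/9 * (m1 (-1/8) * F0)) = _ at b
  have b2 : m1 (-1/8) ^ 2 * (F0 * (31 * F0 + 1012 * (-9/64000) * F0d)) = 160 / (Real.sqrt 3 * π) := by
    have : (160:ℝ) / (Real.sqrt 3 * π) = -45 * (-32 / (9 * Real.sqrt 3 * π)) := by
      have := Real.pi_pos
      have : 0 < Real.sqrt 3 := by positivity
      field_simp; norm_num
    rw [this, ← b]; ring
  rw [e4] at b2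
  have h30 : Real.sqrt 30 = Real.sqrt 3 * Real.sqrt 10 := by
    rw [← Real.sqrt_mul (by norm_num)]; norm_num
  have hpi := Real.pi_pos
  have h3 : 0 < Real.sqrt 3 := by positivity
  have h10 : 0 < Real.sqrt 10 := by positivity
  have s3 : Real.sqrt 3 ^ 2 = 3 := Real.sq_sqrt (by norm_num)
  have : F0 * (31 * F0 + 1012 * (-9/64000) * F0d)
      = Real.sqrt 10 / 3 * (3 / Real.sqrt 10 * (F0 * (31 * F0 + 1012 * (-9/64000) * F0d))) := by
    field_simp
  rw [this, b2, h30]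
  field_simp
  linear_combination (-3) * s3

lemma z0_abs : |(-9/64000:ℝ)| < 1 := by rw [abs_lt]; norm_num

lemma cl_deriv : psum (Dc cl) (-9/64000) = 2 * F0 * F0d := by
  have hb : PBd (hc (1/12) (5/12)) := hc_bd (by norm_num) (by norm_num) (by norm_num) (by norm_num)
  have d1 := cl_bd.hasDerivAt z0_abs
  have d2 := (hb.hasDerivAt z0_abs).pow 2
  have ev : (psum (hc (1/12) (5/12))) ^ 2 =ᶠ[𝓝 (-9/64000:ℝ)] psum cl := by
    have : {x : ℝ | |x| < 1} ∈ 𝓝 (-9/64000:ℝ) :=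
      (isOpen_lt continuous_abs continuous_const).mem_nhds z0_abs
    filter_upwards [this] with x hx
    exact clausen hx
  have := d1.unique (d2.congr_of_eventuallyEq ev.symm)
  rw [this, F0, F0d]
  simp

lemma poch_succ (a : ℝ) (n : ℕ) : poch a (n + 1) = poch a n * (a + n) := by
  rw [poch, poch, ascPochhammer_succ_eval]

lemma poch_eq (a : ℝ) (n : ℕ) : poch 1 n ≠ 0 ∧ poch a n = rr a n * poch 1 n := by
  induction n with
  | zero => simp [poch, rr_zero]
  | succ n ih =>
    obtain ⟨h1, h2⟩ := ih
    have hn : (1:ℝ) + n ≠ 0 := by positivity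
    rw [poch_succ, poch_succ, rr_succ]
    refine ⟨mul_ne_zero h1 hn, ?_⟩
    rw [h2]
    field_simp

theorem stmt_16 :
    ∑' n : ℕ, (poch (1/2) n * poch (1/6) n * poch (5/6) n) / (poch 1 n)^3 * (4554*(n:ℝ)+279) * ((-9:ℝ)/64000)^n = 160 * Real.sqrt 30 / π := by
  have s0 := (cl_bd.summable z0_abs).hasSum
  have s1 := (cl_bd.dc.summable z0_abs).hasSum
  have e1 := hasSum_shift (f := fun n : ℕ => (n:ℝ) * cl n * (-9/64000) ^ n) (x := -9/64000) s1
    (by simp) (fun n => by simp only [Dc]; push_cast; ring)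
  have tot := (e1.mul_left 4554).add (s0.mul_left 279)
  have hterm : ∀ n : ℕ, (poch (1/2) n * poch (1/6) n * poch (5/6) n) / (poch 1 n)^3 *
      (4554*(n:ℝ)+279) * ((-9:ℝ)/64000)^n
      = 4554 * ((n:ℝ) * cl n * (-9/64000) ^ n) + 279 * (cl n * (-9/64000) ^ n) := by
    intro n
    have h1 := (poch_eq 1 n).1
    rw [(poch_eq (1/2) n).2, (poch_eq (1/6) n).2, (poch_eq (5/6) n).2, cl]
    have : rr (1/2) n * poch 1 n * (rr (1/6) n * poch 1 n) * (rr (5/6) n * poch 1 n) / poch 1 n ^ 3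
        = rr (1/2) n * rr (1/6) n * rr (5/6) n := by
      field_simp
    rw [this]; ring
  rw [tsum_congr hterm, tot.tsum_eq]
  have c0 : (∑' n, cl n * (-9/64000:ℝ) ^ n) = F0 ^ 2 := (clausen z0_abs).symm
  have c1 : (∑' n, Dc cl n * (-9/64000:ℝ) ^ n) = 2 * F0 * F0d := cl_deriv
  rw [c0, c1]
  have m := main_value
  have : 160 * Real.sqrt 30 / π = 9 * (160 * Real.sqrt 30 / (9 * π)) := by
    have := Real.pi_pos
    field_simp
  rw [this, ← m]
  ring
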